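/- Let f: C'(b_1,…,b_n) → C be a local map from a semistandard complex (n odd) to a knot-like complex C. Then there exists some b_{n+1} > 0 and a short local map g: C(b_1,…,b_n, b_{n+1}) ⇝ C from the standard complex C(b_1,…,b_n, b_{n+1}) to C which agrees with f on x_0,…,x_n. -/

import Mathlib

/-!
Common setup: the ring `R = 𝔽₂[U,V]/(UV = 0)`, bigraded free finitely generated chain
complexes over `R` ("pre-complexes"), knot-like complexes, local maps and local
equivalence, standard and semistandard complexes, short maps, the `Z^!` order,
the invariants `a_i`, `φ_j`, `P`, shift maps, tensor products, duals, and direct sums.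
-/

set_option synthInstance.maxHeartbeats 1000000
set_option maxHeartbeats 1000000

noncomputable section

/-- The polynomial ring `𝔽₂[U,V]`. -/
abbrev PolyUV : Type := MvPolynomial (Fin 2) (ZMod 2)

/-- The ideal `(U·V)`. -/
def IUV : Ideal PolyUV := Ideal.span {(MvPolynomial.X 0 * MvPolynomial.X 1 : PolyUV)}

/-- The ring `R = 𝔽₂[U,V]/(UV = 0)`. -/
abbrev RUV : Type := PolyUV ⧸ IUV

instance : CommRing RUV := Ideal.Quotient.commRing IUV

/-- The image of `U` in `R`. -/
def Uv : RUV := Ideal.Quotient.mk IUV (MvPolynomial.X 0)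

/-- The image of `V` in `R`. -/
def Vv : RUV := Ideal.Quotient.mk IUV (MvPolynomial.X 1)

/-- `r ∈ R` is homogeneous of bidegree `(p, q)` for the bigrading with
`gr(U) = (-2, 0)`, `gr(V) = (0, -2)`, `gr(1) = (0, 0)` (coefficients in `𝔽₂`). -/
def IsHomog (r : RUV) (p q : ℤ) : Prop :=
  r = 0 ∨ (∃ a : ℕ, r = Uv ^ a ∧ p = -(2 * (a : ℤ)) ∧ q = 0) ∨
    (∃ b : ℕ, r = Vv ^ b ∧ p = 0 ∧ q = -(2 * (b : ℤ)))

/-- A finitely generated free bigraded module over `R` with a distinguished basis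
indexed by `Fin n`, together with a bigrading `gr` on the basis and a matrix `dm`
recording a prospective differential: `dm i j` is the coefficient of the `j`-th basis
vector in the differential of the `i`-th basis vector. -/
structure PreCx where
  n : ℕ
  gr : Fin n → ℤ × ℤ
  dm : Fin n → Fin n → RUV

/-- The underlying free `R`-module of a pre-complex. -/
abbrev Msub (C : PreCx) : Type := Fin C.n →₀ RUV

/-- The differential of a pre-complex, as an `R`-linear map. -/
def dmap (C : PreCx) : Msub C →ₗ[RUV] Msub C :=
  Finsupp.linearCombination RUV fun i => ∑ j, Finsupp.single j (C.dm i j)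

/-- The submodule `U·C ⊆ C`; `C/U` is the quotient by this submodule. -/
def uSub (C : PreCx) : Submodule RUV (Msub C) :=
  LinearMap.range (LinearMap.lsmul RUV (Msub C) Uv)

/-- The submodule `V·C ⊆ C`; `C/V` is the quotient by this submodule. -/
def vSub (C : PreCx) : Submodule RUV (Msub C) :=
  LinearMap.range (LinearMap.lsmul RUV (Msub C) Vv)

/-- Chains which die in the homology of `C/U`: the preimage in `C` of the boundaries of
the induced differential on `C/U`. -/
def bdryU (C : PreCx) : Submodule RUV (Msub C) := uSub C ⊔ LinearMap.range (dmap C)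

/-- Chains which die in the homology of `C/V`. -/
def bdryV (C : PreCx) : Submodule RUV (Msub C) := vSub C ⊔ LinearMap.range (dmap C)

/-- A chain `x ∈ C` is homogeneous of bidegree `(p, q)`. -/
def ChainHomog (C : PreCx) (x : Msub C) (p q : ℤ) : Prop :=
  ∀ j, IsHomog (x j) (p - (C.gr j).1) (q - (C.gr j).2)

/-- `x` is a `V`-tower class generator: its class in `H_*(C/U)` is a `V`-nontorsion cycle
whose image generates `H_*(C/U)/(V-torsion)` (equivalently, it is maximally `V`-graded
among `V`-nontorsion classes). -/
def IsVTowerGen (C : PreCx) (x : Msub C) : Prop :=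
  dmap C x ∈ uSub C ∧ (∀ k : ℕ, Vv ^ k • x ∉ bdryU C) ∧
    ∀ z : Msub C, dmap C z ∈ uSub C →
      ∃ (r : RUV) (k : ℕ), Vv ^ k • (z - r • x) ∈ bdryU C

/-- `x` is a `U`-tower class generator: its class in `H_*(C/V)` is a `U`-nontorsion cycle
whose image generates `H_*(C/V)/(U-torsion)`. -/
def IsUTowerGen (C : PreCx) (x : Msub C) : Prop :=
  dmap C x ∈ vSub C ∧ (∀ k : ℕ, Uv ^ k • x ∉ bdryV C) ∧
    ∀ z : Msub C, dmap C z ∈ vSub C →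
      ∃ (r : RUV) (k : ℕ), Uv ^ k • (z - r • x) ∈ bdryV C

/-- `C` is a chain complex over `R` whose differential has degree `(-1, -1)`. -/
def IsCplx (C : PreCx) : Prop :=
  (∀ x, dmap C (dmap C x) = 0) ∧
    ∀ i j, IsHomog (C.dm i j) ((C.gr i).1 - 1 - (C.gr j).1) ((C.gr i).2 - 1 - (C.gr j).2)

/-- A knot-like complex: a free, finitely generated, bigraded chain complex over `R`
whose differential has degree `(-1,-1)`, such that `H_*(C/U)/(V`-torsion`) ≅ 𝔽₂[V]` with
all `V`-nontorsion elements of `H_*(C/U)` in `U`-grading `0`, and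
`H_*(C/V)/(U`-torsion`) ≅ 𝔽₂[U]` with all `U`-nontorsion elements of `H_*(C/V)` in
`V`-grading `0`. -/
structure IsKnotLike (C : PreCx) : Prop where
  dsq : ∀ x, dmap C (dmap C x) = 0
  dhomog : ∀ i j, IsHomog (C.dm i j)
    ((C.gr i).1 - 1 - (C.gr j).1) ((C.gr i).2 - 1 - (C.gr j).2)
  vTowerExists : ∃ x, IsVTowerGen C x
  vTowerGr : ∀ x p q, ChainHomog C x p q → dmap C x ∈ uSub C →
    (∀ k : ℕ, Vv ^ k • x ∉ bdryU C) → p = 0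
  uTowerExists : ∃ x, IsUTowerGen C x
  uTowerGr : ∀ x p q, ChainHomog C x p q → dmap C x ∈ vSub C →
    (∀ k : ℕ, Uv ^ k • x ∉ bdryV C) → q = 0

/-- A module map `f : C₁ → C₂` is homogeneous of bidegree `(s, t)`. -/
def MapHomogShift (C₁ C₂ : PreCx) (f : Msub C₁ →ₗ[RUV] Msub C₂) (s t : ℤ) : Prop :=
  ∀ i j, IsHomog (f (Finsupp.single i 1) j)
    ((C₁.gr i).1 + s - (C₂.gr j).1) ((C₁.gr i).2 + t - (C₂.gr j).2)

/-- A local map `f : C₁ → C₂`: an absolutely `U`-graded, relatively `V`-graded,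
`R`-equivariant chain map inducing an isomorphism on `H_*(·/U)/(V-torsion)`
(equivalently, taking `V`-tower generators to `V`-tower generators). -/
structure IsLocalMap (C₁ C₂ : PreCx) (f : Msub C₁ →ₗ[RUV] Msub C₂) : Prop where
  chain : ∀ x, f (dmap C₁ x) = dmap C₂ (f x)
  graded : ∃ s : ℤ, MapHomogShift C₁ C₂ f 0 s
  towers : ∀ x, IsVTowerGen C₁ x → IsVTowerGen C₂ (f x)

/-- `C₁ ≤ C₂`: there exists a local map `C₁ → C₂`. -/
def LocalLE (C₁ C₂ : PreCx) : Prop := ∃ f, IsLocalMap C₁ C₂ f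

/-- Local equivalence of complexes: local maps in both directions. -/
def LocalEquiv (C₁ C₂ : PreCx) : Prop := LocalLE C₁ C₂ ∧ LocalLE C₂ C₁

/-- `C` is reduced: `∂ ≡ 0 mod (U, V)`. -/
def Reduced (C : PreCx) : Prop := ∀ i j, C.dm i j ∈ Ideal.span ({Uv, Vv} : Set RUV)

/-! ### Standard complexes -/

/-- The shift in bigrading from `x_k` to `x_{k+1}` in a standard complex, where the
parameter joining them is `b` (`k` is the 0-based index of the parameter, so the
parameter is a `U`-power arrow if `k` is even and a `V`-power arrow if `k` is odd). -/
def stepShift (k : ℕ) (b : ℤ) : ℤ × ℤ :=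
  if k % 2 = 0 then
    if b < 0 then (2 * (b.natAbs : ℤ) - 1, -1) else (1 - 2 * (b.natAbs : ℤ), 1)
  else
    if b < 0 then (-1, 2 * (b.natAbs : ℤ) - 1) else (1, 1 - 2 * (b.natAbs : ℤ))

/-- Bigrading of `x_i` relative to `x_0` in the standard complex with parameters `L`. -/
def grRel (L : List ℤ) (i : ℕ) : ℤ × ℤ :=
  ∑ k ∈ Finset.range i, stepShift k (L.getD k 0)

/-- The bigrading of the standard complex of parameters `L`, normalized so that
`gr_U(x_0) = 0` and `gr_V(x_n) = 0`. -/
def stdGr (L : List ℤ) (i : Fin (L.length + 1)) : ℤ × ℤ :=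
  ((grRel L (i : ℕ)).1, (grRel L (i : ℕ)).2 - (grRel L L.length).2)

/-- The differential matrix of the standard complex of parameters `L = (b_1, …, b_n)`:
for `i` odd (1-based), `∂_U x_{i-1} = U^{|b_i|} x_i` if `b_i < 0` and
`∂_U x_i = U^{b_i} x_{i-1}` if `b_i > 0`; for `i` even the same with `V` in place of `U`;
all other differentials vanish. -/
def stdDm (L : List ℤ) (i j : Fin (L.length + 1)) : RUV :=
  if (j : ℕ) = (i : ℕ) + 1 ∧ L.getD (i : ℕ) 0 < 0 then
    (if (i : ℕ) % 2 = 0 then Uv else Vv) ^ (L.getD (i : ℕ) 0).natAbs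
  else if (i : ℕ) = (j : ℕ) + 1 ∧ 0 < L.getD (j : ℕ) 0 then
    (if (j : ℕ) % 2 = 0 then Uv else Vv) ^ (L.getD (j : ℕ) 0).natAbs
  else 0

/-- The standard complex `C(b_1, …, b_n)` of a list of parameters `L = (b_1, …, b_n)`,
with generators `x_0, …, x_n`.  (For `L = []` this is the trivial complex `R`.) -/
def StdCx (L : List ℤ) : PreCx := ⟨L.length + 1, stdGr L, stdDm L⟩

/-- `L` is a valid parameter sequence for a standard complex: all entries are nonzero
and the length is even (possibly zero). -/
def IsStdSeq (L : List ℤ) : Prop := (∀ b ∈ L, b ≠ 0) ∧ Even L.length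

/-- The trivial standard complex `C(0) = R`. -/
def trivCx : PreCx := StdCx []

/-- The bigrading of the semistandard complex `C'(b_1, …, b_n)` (`n` odd), inherited from
the ambient standard complex `C(b_1, …, b_n, 1)`. -/
def semiGr (L : List ℤ) (i : Fin (L.length + 1)) : ℤ × ℤ :=
  ((grRel L (i : ℕ)).1, (grRel L (i : ℕ)).2 - (grRel L L.length).2 + 1)

/-- The semistandard complex `C'(b_1, …, b_n)` (`n` odd): the subcomplex of
`C(b_1, …, b_n, 1)` generated by `x_0, …, x_n`. -/
def SemiStdCx (L : List ℤ) : PreCx := ⟨L.length + 1, semiGr L, stdDm L⟩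

/-! ### Tensor products, duals, direct sums -/

/-- The tensor product (over `R`) of two pre-complexes, with basis `x_i ⊗ y_j` and
differential `∂(x ⊗ y) = ∂x ⊗ y + x ⊗ ∂y` (signs are irrelevant in characteristic 2). -/
def tensorCx (C₁ C₂ : PreCx) : PreCx where
  n := C₁.n * C₂.n
  gr := fun p => C₁.gr (finProdFinEquiv.symm p).1 + C₂.gr (finProdFinEquiv.symm p).2
  dm := fun p q =>
    (if (finProdFinEquiv.symm p).2 = (finProdFinEquiv.symm q).2 then
      C₁.dm (finProdFinEquiv.symm p).1 (finProdFinEquiv.symm q).1 else 0) +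
    (if (finProdFinEquiv.symm p).1 = (finProdFinEquiv.symm q).1 then
      C₂.dm (finProdFinEquiv.symm p).2 (finProdFinEquiv.symm q).2 else 0)

/-- The dual complex `C^∨ = Hom_R(C, R)`, described on the dual basis: the gradings are
negated and the differential matrix is transposed. -/
def dualCx (C : PreCx) : PreCx := ⟨C.n, fun i => -C.gr i, fun i j => C.dm j i⟩

/-- The direct sum of two pre-complexes. -/
def sumCx (C₁ C₂ : PreCx) : PreCx where
  n := C₁.n + C₂.n
  gr := fun p => Sum.elim C₁.gr C₂.gr (finSumFinEquiv.symm p)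
  dm := fun p q =>
    match finSumFinEquiv.symm p, finSumFinEquiv.symm q with
    | Sum.inl i, Sum.inl k => C₁.dm i k
    | Sum.inr j, Sum.inr l => C₂.dm j l
    | _, _ => 0

/-- A homotopy equivalence of bigraded chain complexes over `R`: chain maps `f, g`
preserving the bigrading, with `g ∘ f ≃ id` and `f ∘ g ≃ id` via `R`-equivariant
homotopies of bidegree `(1, 1)`. -/
def HomotopyEquivCx (C₁ C₂ : PreCx) : Prop :=
  ∃ (f : Msub C₁ →ₗ[RUV] Msub C₂) (g : Msub C₂ →ₗ[RUV] Msub C₁)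
    (H : Msub C₁ →ₗ[RUV] Msub C₁) (K : Msub C₂ →ₗ[RUV] Msub C₂),
    (∀ x, f (dmap C₁ x) = dmap C₂ (f x)) ∧
    (∀ y, g (dmap C₂ y) = dmap C₁ (g y)) ∧
    MapHomogShift C₁ C₂ f 0 0 ∧ MapHomogShift C₂ C₁ g 0 0 ∧
    MapHomogShift C₁ C₁ H 1 1 ∧ MapHomogShift C₂ C₂ K 1 1 ∧
    (∀ x, g (f x) - x = dmap C₁ (H x) + H (dmap C₁ x)) ∧
    (∀ y, f (g y) - y = dmap C₂ (K y) + K (dmap C₂ y))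

/-- An isomorphism of bigraded chain complexes over `R`. -/
def IsBigradedChainIso (C₁ C₂ : PreCx) (f : Msub C₁ →ₗ[RUV] Msub C₂) : Prop :=
  Function.Bijective f ∧ (∀ x, f (dmap C₁ x) = dmap C₂ (f x)) ∧ MapHomogShift C₁ C₂ f 0 0

/-! ### Short maps -/

/-- A short map `f : C(b_1, …, b_n) ⇝ C`: an absolutely `U`-graded, relatively
`V`-graded `R`-module map which is a chain map at `x_1, …, x_{n-1}` and commutes with
the `V`-part of the differential at `x_n` (for reduced `C`, the failure
`∂ f(x_n) - f(∂_V x_n)` is exactly `∂_U f(x_n) ∈ U·C`). -/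
def IsShortMap (L : List ℤ) (C : PreCx) (f : Msub (StdCx L) →ₗ[RUV] Msub C) : Prop :=
  (∃ s : ℤ, MapHomogShift (StdCx L) C f 0 s) ∧
  (∀ i : Fin (L.length + 1), 1 ≤ (i : ℕ) → (i : ℕ) + 1 ≤ L.length →
    f (dmap (StdCx L) (Finsupp.single i 1)) = dmap C (f (Finsupp.single i 1))) ∧
  dmap C (f (Finsupp.single (Fin.last L.length) 1)) -
    f (dmap (StdCx L) (Finsupp.single (Fin.last L.length) 1)) ∈ uSub C

/-- A short local map: a short map sending the `V`-tower generator `x_0` to a `V`-tower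
generator (hence inducing an isomorphism on `H_*(·/U)/(V-torsion)`). -/
def IsShortLocalMap (L : List ℤ) (C : PreCx) (f : Msub (StdCx L) →ₗ[RUV] Msub C) : Prop :=
  IsShortMap L C f ∧ IsVTowerGen C (f (Finsupp.single (0 : Fin (L.length + 1)) 1))

/-- A local map from the semistandard complex `C'(b_1, …, b_n)` to a knot-like complex:
a grading-preserving `R`-equivariant chain map under which the class of `x_0`
generates `H_*(C/U)/(V-torsion)`. -/
def IsSemiLocalMap (L : List ℤ) (C : PreCx) (f : Msub (SemiStdCx L) →ₗ[RUV] Msub C) : Prop :=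
  (∀ x, f (dmap (SemiStdCx L) x) = dmap C (f x)) ∧
  MapHomogShift (SemiStdCx L) C f 0 0 ∧
  IsVTowerGen C (f (Finsupp.single (0 : Fin (L.length + 1)) 1))

/-! ### The order `Z^!` and the numerical invariants -/

/-- The embedding of `Z^!` into `ℚ` realizing the order
`-1 <^! -2 <^! ⋯ <^! 0 <^! ⋯ <^! 2 <^! 1`: send `0 ↦ 0` and `a ↦ 1/a` otherwise. -/
def qval (a : ℤ) : ℚ := if a = 0 then 0 else 1 / (a : ℚ)

/-- The order `≤^!` on `Z^!`. -/
def bangLE (a b : ℤ) : Prop := qval a ≤ qval b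

/-- Pad a finite sequence with trailing zeros. -/
def seqPad (L : List ℤ) (i : ℕ) : ℤ := L.getD i 0

/-- The lexicographic order on finite integer sequences induced by `≤^!`, padding the
shorter sequence with trailing zeros. -/
def bangLexLE (L₁ L₂ : List ℤ) : Prop :=
  (∀ i, seqPad L₁ i = seqPad L₂ i) ∨
    ∃ k, (∀ i < k, seqPad L₁ i = seqPad L₂ i) ∧ qval (seqPad L₁ k) < qval (seqPad L₂ k)

/-- `m` is an upper bound for `S ⊆ Z^!` with respect to `≤^!`. -/
def IsBangUB (S : Set ℤ) (m : ℤ) : Prop := ∀ b ∈ S, qval b ≤ qval m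

/-- `m = sup^! S`, the least upper bound of `S ⊆ Z^!` with respect to `≤^!`. -/
def IsBangLUB (S : Set ℤ) (m : ℤ) : Prop :=
  IsBangUB S m ∧ ∀ m' : ℤ, IsBangUB S m' → qval m ≤ qval m'

/-- Candidate set for the next invariant: given the already-constructed prefix `P`,
those nonzero `b` such that some standard complex `C(P, b, rest) ≤ C`. -/
def candSet (C : PreCx) (P : List ℤ) : Set ℤ :=
  {b | b ≠ 0 ∧ ∃ rest : List ℤ, IsStdSeq (P ++ b :: rest) ∧ LocalLE (StdCx (P ++ b :: rest)) C}

/-- `a` is the sequence of numerical invariants `a_i(C)` (indexed from `0`):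
once a term vanishes all later terms vanish, and otherwise each term is
`sup^!` of the corresponding candidate set. -/
def InvSeq (C : PreCx) (a : ℕ → ℤ) : Prop :=
  ∀ k : ℕ,
    ((∃ i < k, a i = 0) → a k = 0) ∧
    ((∀ i < k, a i ≠ 0) → IsBangLUB (candSet C ((List.range k).map a)) (a k))

/-- The first `n` terms of `a`, with the (all-zero) tail deleted. -/
def truncSeq (a : ℕ → ℤ) (n : ℕ) : List ℤ :=
  ((List.range n).map a).takeWhile (fun b => b != 0)

/-! ### The homomorphisms `φ_j`, `P` and the shifts `sh_m` -/

/-- `φ_j` of a standard complex `C(a_1, …, a_n)`: the signed count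
`#{i odd : a_i = j} − #{i odd : a_i = −j}` (with 1-based odd `i`). -/
def phi (j : ℕ) (L : List ℤ) : ℤ :=
  ∑ i ∈ Finset.range L.length,
    if i % 2 = 0 then
      (if L.getD i 0 = (j : ℤ) then 1 else 0) - (if L.getD i 0 = -(j : ℤ) then 1 else 0)
    else 0

/-- The shift `sh_m` on parameter sequences: entries of absolute value `≥ m` are pushed
one further from zero; entries of absolute value `< m` are fixed. -/
def shSeq (m : ℕ) (L : List ℤ) : List ℤ :=
  L.map fun a => if (m : ℤ) ≤ a then a + 1 else if a ≤ -(m : ℤ) then a - 1 else a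

/-- `P(C) = -2 ∑_{j>0} j φ_j(C) + ∑_i sgn a_i`, computed from the parameter sequence of
the standard representative (the sum over `j` is finite since `φ_j` vanishes for
`j` larger than any `|a_i|`). -/
def Pval (L : List ℤ) : ℤ :=
  -2 * (∑ j ∈ Finset.range ((L.map Int.natAbs).sum + 1), (j : ℤ) * phi j L) +
    (L.map Int.sign).sum

end

noncomputable section

/-! ### The bigrading of `R` and homogeneous components -/

/-- The weights of the variables `U` and `V` in `ℤ × ℤ`. -/
def uvWeight : Fin 2 → ℤ × ℤ := ![(-2, 0), (0, -2)]

lemma weight_uvWeight (m : Fin 2 →₀ ℕ) :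
    Finsupp.weight uvWeight m = (-(2 * (m 0 : ℤ)), -(2 * (m 1 : ℤ))) := by
  rw [Finsupp.weight_apply, Finsupp.sum_fintype _ _ (by simp)]
  simp [uvWeight, Fin.sum_univ_two, Prod.ext_iff, mul_comm]

lemma weight_uvWeight_injective :
    Function.Injective fun m : Fin 2 →₀ ℕ => Finsupp.weight uvWeight m := by
  intro m m' h
  simp only [weight_uvWeight, Prod.mk.injEq] at h
  ext i
  fin_cases i
  · simp only [Fin.zero_eta]; omega
  · simp only [Fin.mk_one]; omega

lemma mk_monomial_one (m : Fin 2 →₀ ℕ) :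
    Ideal.Quotient.mk IUV (MvPolynomial.monomial m 1) = Uv ^ m 0 * Vv ^ m 1 := by
  rw [MvPolynomial.monomial_eq, Finsupp.prod_fintype _ _ (by simp)]
  simp [Uv, Vv]

lemma Uv_mul_Vv : Uv * Vv = 0 := by
  rw [Uv, Vv, ← map_mul, Ideal.Quotient.eq_zero_iff_mem]
  exact Ideal.subset_span rfl

/-- Homogeneous elements of `R` are exactly the images of weighted homogeneous polynomials. -/
lemma isHomog_iff {r : RUV} {p q : ℤ} :
    IsHomog r p q ↔ ∃ P : PolyUV, MvPolynomial.IsWeightedHomogeneous uvWeight P (p, q) ∧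
      Ideal.Quotient.mk IUV P = r := by
  constructor
  · rintro (rfl | ⟨a, rfl, rfl, rfl⟩ | ⟨b, rfl, rfl, rfl⟩)
    · exact ⟨0, MvPolynomial.isWeightedHomogeneous_zero _ _ _, map_zero _⟩
    · refine ⟨MvPolynomial.X 0 ^ a, ?_, by simp [Uv]⟩
      convert (MvPolynomial.isWeightedHomogeneous_X (ZMod 2) uvWeight 0).pow a using 1
      simp [uvWeight, mul_comm]
    · refine ⟨MvPolynomial.X 1 ^ b, ?_, by simp [Vv]⟩
      convert (MvPolynomial.isWeightedHomogeneous_X (ZMod 2) uvWeight 1).pow b using 1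
      simp [uvWeight, mul_comm]
  · rintro ⟨P, hP, rfl⟩
    by_cases h0 : P = 0
    · left; simp [h0]
    obtain ⟨m, hm⟩ := MvPolynomial.ne_zero_iff.1 h0
    have hw := hP hm
    have hPm : P = MvPolynomial.monomial m 1 := by
      have h1 : MvPolynomial.coeff m P = 1 := Fin.eq_one_of_ne_zero _ hm
      ext m'
      by_cases h : m = m'
      · subst h; simpa using h1
      · rw [MvPolynomial.coeff_monomial, if_neg h]
        by_contra h'
        exact h (weight_uvWeight_injective (hw.trans (hP h').symm))
    rw [weight_uvWeight, Prod.mk.injEq] at hw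
    rw [hPm, mk_monomial_one]
    rcases Nat.eq_zero_or_pos (m 1) with h1 | h1
    · right; left
      exact ⟨m 0, by simp [h1], hw.1.symm, by rw [← hw.2, h1]; simp⟩
    rcases Nat.eq_zero_or_pos (m 0) with h2 | h2
    · right; right
      exact ⟨m 1, by simp [h2], by rw [← hw.1, h2]; simp, hw.2.symm⟩
    · left
      obtain ⟨a, ha⟩ := Nat.exists_eq_add_of_lt h1
      obtain ⟨b, hb⟩ := Nat.exists_eq_add_of_lt h2
      rw [ha, hb]
      linear_combination Uv ^ b * Vv ^ a * Uv_mul_Vv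

lemma IsHomog.mul {r s : RUV} {p q p' q' : ℤ} (hr : IsHomog r p q) (hs : IsHomog s p' q') :
    IsHomog (r * s) (p + p') (q + q') := by
  obtain ⟨P, hP, rfl⟩ := isHomog_iff.1 hr
  obtain ⟨Q, hQ, rfl⟩ := isHomog_iff.1 hs
  exact isHomog_iff.2 ⟨P * Q, hP.mul hQ, map_mul _ _ _⟩

lemma isHomog_Uv : IsHomog Uv (-2) 0 := Or.inr (Or.inl ⟨1, by simp⟩)

lemma isHomog_Vv_pow (b : ℕ) : IsHomog (Vv ^ b) 0 (-(2 * (b : ℤ))) :=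
  Or.inr (Or.inr ⟨b, rfl, rfl, rfl⟩)

open MvPolynomial in
lemma weightedHomogeneousComponent_mem_IUV {P : PolyUV} (hP : P ∈ IUV) (d : ℤ × ℤ) :
    weightedHomogeneousComponent uvWeight d P ∈ IUV := by
  let _ := weightedGradedAlgebra (ZMod 2) uvWeight
  refine weightedHomogeneousComponent_mem_of_mem (ZMod 2) uvWeight ?_ hP d
  apply Ideal.homogeneous_span
  rintro x rfl
  exact ⟨_, (isWeightedHomogeneous_X _ _ _).mul (isWeightedHomogeneous_X _ _ _)⟩

open MvPolynomial in
lemma weightedHomogeneousComponent_mul {P : PolyUV} {c : ℤ × ℤ}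
    (hP : IsWeightedHomogeneous uvWeight P c) (d : ℤ × ℤ) (Q : PolyUV) :
    weightedHomogeneousComponent uvWeight (c + d) (P * Q) =
      P * weightedHomogeneousComponent uvWeight d Q := by
  let _ := weightedGradedAlgebra (ZMod 2) uvWeight
  have := DirectSum.coe_decompose_mul_add_of_left_mem
    (weightedHomogeneousSubmodule (ZMod 2) uvWeight) (i := c) (j := d) (b := Q) hP
  simp_rw [← weightedDecomposition.decompose'_apply]
  exact this

/-- The component of bidegree `(p, q)` of an element of `R`. -/
def homogComp (p q : ℤ) (r : RUV) : RUV :=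
  Ideal.Quotient.mk IUV (MvPolynomial.weightedHomogeneousComponent uvWeight (p, q)
    (Function.surjInv Ideal.Quotient.mk_surjective r))

lemma homogComp_mk (p q : ℤ) (P : PolyUV) :
    homogComp p q (Ideal.Quotient.mk IUV P) =
      Ideal.Quotient.mk IUV (MvPolynomial.weightedHomogeneousComponent uvWeight (p, q) P) := by
  rw [homogComp, Ideal.Quotient.eq, ← map_sub]
  apply weightedHomogeneousComponent_mem_IUV
  exact Ideal.Quotient.eq.1 (Function.surjInv_eq Ideal.Quotient.mk_surjective _)

lemma isHomog_homogComp (p q : ℤ) (r : RUV) : IsHomog (homogComp p q r) p q :=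
  isHomog_iff.2
    ⟨_, MvPolynomial.weightedHomogeneousComponent_isWeightedHomogeneous _ _, rfl⟩

lemma homogComp_add (p q : ℤ) (r s : RUV) :
    homogComp p q (r + s) = homogComp p q r + homogComp p q s := by
  obtain ⟨P, rfl⟩ := Ideal.Quotient.mk_surjective r
  obtain ⟨Q, rfl⟩ := Ideal.Quotient.mk_surjective s
  simp only [← map_add, homogComp_mk]

lemma homogComp_sum {ι : Type*} (s : Finset ι) (r : ι → RUV) (p q : ℤ) :
    homogComp p q (∑ i ∈ s, r i) = ∑ i ∈ s, homogComp p q (r i) :=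
  map_sum (AddMonoidHom.mk' (homogComp p q) (homogComp_add p q)) r s

lemma IsHomog.homogComp_eq {r : RUV} {p q : ℤ} (hr : IsHomog r p q) : homogComp p q r = r := by
  obtain ⟨P, hP, rfl⟩ := isHomog_iff.1 hr
  rw [homogComp_mk, MvPolynomial.weightedHomogeneousComponent_eq_self hP]

lemma IsHomog.homogComp_mul {r : RUV} {p q : ℤ} (hr : IsHomog r p q) (p' q' : ℤ) (s : RUV) :
    homogComp (p + p') (q + q') (r * s) = r * homogComp p' q' s := by
  obtain ⟨P, hP, rfl⟩ := isHomog_iff.1 hr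
  obtain ⟨Q, rfl⟩ := Ideal.Quotient.mk_surjective s
  rw [← map_mul, homogComp_mk, homogComp_mk, ← map_mul, ← weightedHomogeneousComponent_mul hP,
    Prod.mk_add_mk]

/-! ### Homogeneous components of chains -/

/-- The component of bidegree `(p, q)` of a chain. -/
def chainComp (C : PreCx) (p q : ℤ) (x : Msub C) : Msub C :=
  Finsupp.equivFunOnFinite.symm fun j => homogComp (p - (C.gr j).1) (q - (C.gr j).2) (x j)

lemma chainComp_apply (C : PreCx) (p q : ℤ) (x : Msub C) (j : Fin C.n) :
    chainComp C p q x j = homogComp (p - (C.gr j).1) (q - (C.gr j).2) (x j) := rfl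

lemma chainHomog_chainComp (C : PreCx) (p q : ℤ) (x : Msub C) :
    ChainHomog C (chainComp C p q x) p q := fun _ => isHomog_homogComp _ _ _

lemma ChainHomog.chainComp_eq {C : PreCx} {p q : ℤ} {x : Msub C} (hx : ChainHomog C x p q) :
    chainComp C p q x = x := by
  ext j
  exact (hx j).homogComp_eq

lemma ChainHomog.smul {C : PreCx} {p q p' q' : ℤ} {r : RUV} {x : Msub C} (hr : IsHomog r p q)
    (hx : ChainHomog C x p' q') : ChainHomog C (r • x) (p + p') (q + q') := by
  intro j
  rw [Finsupp.smul_apply, smul_eq_mul, add_sub_assoc, add_sub_assoc]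
  exact hr.mul (hx j)

lemma chainComp_add (C : PreCx) (p q : ℤ) (x y : Msub C) :
    chainComp C p q (x + y) = chainComp C p q x + chainComp C p q y := by
  ext j
  exact homogComp_add _ _ _ _

lemma chainComp_smul (C : PreCx) {p q : ℤ} {r : RUV} (hr : IsHomog r p q) (p' q' : ℤ)
    (x : Msub C) : chainComp C (p + p') (q + q') (r • x) = r • chainComp C p' q' x := by
  ext j
  simp only [chainComp_apply, Finsupp.smul_apply, smul_eq_mul, add_sub_assoc]
  exact hr.homogComp_mul _ _ _

lemma dmap_apply (C : PreCx) (x : Msub C) (k : Fin C.n) :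
    dmap C x k = ∑ i, x i * C.dm i k := by
  rw [dmap, Finsupp.linearCombination_apply, Finsupp.sum_fintype _ _ (by simp),
    Finsupp.finsetSum_apply]
  refine Finset.sum_congr rfl fun i _ => ?_
  rw [Finsupp.smul_apply, Finsupp.finsetSum_apply, smul_eq_mul]
  simp [Finsupp.single_apply]

lemma dmap_single (C : PreCx) (i : Fin C.n) :
    dmap C (Finsupp.single i 1) = ∑ j, C.dm i j • Finsupp.single j (1 : RUV) := by
  simp [dmap]

lemma map_dmap_single (C : PreCx) {M : Type*} [AddCommGroup M] [Module RUV M]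
    (g : Msub C →ₗ[RUV] M) (i : Fin C.n) :
    g (dmap C (Finsupp.single i 1)) = ∑ j, C.dm i j • g (Finsupp.single j 1) := by
  simp only [dmap_single, map_sum, map_smul]

lemma dmap_single_mem_uSub (C : PreCx) (i : Fin C.n) (h : ∀ j, ∃ r, C.dm i j = Uv * r) :
    dmap C (Finsupp.single i 1) ∈ uSub C := by
  rw [dmap_single]
  refine Submodule.sum_mem _ fun j _ => ?_
  obtain ⟨r, hr⟩ := h j
  exact ⟨r • Finsupp.single j 1, by rw [LinearMap.lsmul_apply, smul_smul, ← hr]⟩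

lemma chainComp_dmap {C : PreCx}
    (hC : ∀ i j, IsHomog (C.dm i j) ((C.gr i).1 - 1 - (C.gr j).1) ((C.gr i).2 - 1 - (C.gr j).2))
    (p q : ℤ) (x : Msub C) :
    chainComp C p q (dmap C x) = dmap C (chainComp C (p + 1) (q + 1) x) := by
  ext k
  rw [chainComp_apply, dmap_apply, dmap_apply, homogComp_sum]
  refine Finset.sum_congr rfl fun i _ => ?_
  rw [chainComp_apply, mul_comm, mul_comm _ (C.dm i k), ← (hC i k).homogComp_mul]
  congr 1 <;> ring

/-- A homogeneous chain which bounds in `C/U` bounds a homogeneous chain there. -/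
lemma exists_homog_of_mem_bdryU {C : PreCx}
    (hC : ∀ i j, IsHomog (C.dm i j) ((C.gr i).1 - 1 - (C.gr j).1) ((C.gr i).2 - 1 - (C.gr j).2))
    {p q : ℤ} {x : Msub C} (hx : ChainHomog C x p q) (hb : x ∈ bdryU C) :
    ∃ y, ChainHomog C y (p + 1) (q + 1) ∧ dmap C y - x ∈ uSub C := by
  obtain ⟨_, ⟨u, rfl⟩, _, ⟨y, rfl⟩, h⟩ := Submodule.mem_sup.1 hb
  refine ⟨chainComp C (p + 1) (q + 1) y, chainHomog_chainComp _ _ _ _,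
    -chainComp C (p + 2) q u, ?_⟩
  have h1 : chainComp C p q (Uv • u) = Uv • chainComp C (p + 2) q u := by
    rw [← chainComp_smul C isHomog_Uv]
    congr 1 <;> ring
  rw [← hx.chainComp_eq, ← h, chainComp_add, chainComp_dmap hC, LinearMap.lsmul_apply,
    LinearMap.lsmul_apply, h1]
  simp

/-! ### Standard and semistandard complexes -/

lemma MapHomogShift.chainHomog {C₁ C₂ : PreCx} {f : Msub C₁ →ₗ[RUV] Msub C₂} {s t : ℤ}
    (hf : MapHomogShift C₁ C₂ f s t) (i : Fin C₁.n) :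
    ChainHomog C₂ (f (Finsupp.single i 1)) ((C₁.gr i).1 + s) ((C₁.gr i).2 + t) :=
  hf i

lemma odd_stepShift_fst (k : ℕ) (b : ℤ) : Odd (stepShift k b).1 := by
  unfold stepShift
  split_ifs
  · exact ⟨(b.natAbs : ℤ) - 1, by ring⟩
  · exact ⟨-(b.natAbs : ℤ), by ring⟩
  · exact ⟨-1, by norm_num⟩
  · exact ⟨0, by norm_num⟩

lemma grRel_succ (L : List ℤ) (i : ℕ) :
    grRel L (i + 1) = grRel L i + stepShift i (L.getD i 0) := Finset.sum_range_succ _ _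

lemma odd_grRel_fst_iff (L : List ℤ) (i : ℕ) : Odd (grRel L i).1 ↔ Odd i := by
  induction i with
  | zero => simp [grRel]
  | succ i ih =>
    have := odd_stepShift_fst i (L.getD i 0)
    rw [grRel_succ, Prod.fst_add, Int.odd_add, ih, Nat.odd_add_one, ← Int.not_odd_iff_even]
    tauto

lemma grRel_append (L L' : List ℤ) {i : ℕ} (hi : i ≤ L.length) :
    grRel (L ++ L') i = grRel L i := by
  refine Finset.sum_congr rfl fun k hk => ?_
  rw [List.getD_append _ _ _ _ ((Finset.mem_range.1 hk).trans_le hi)]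

/-- The last generator of a semistandard complex is a cycle modulo `U`. -/
lemma dmap_semiStd_last_mem_uSub (L : List ℤ) (hodd : Odd L.length) :
    dmap (SemiStdCx L) (Finsupp.single (Fin.last L.length) 1) ∈ uSub (SemiStdCx L) := by
  refine dmap_single_mem_uSub (SemiStdCx L) _ fun j : Fin (L.length + 1) => ?_
  change ∃ r, stdDm L (Fin.last L.length) j = Uv * r
  have hj := j.isLt
  unfold stdDm
  rw [if_neg (by simp only [Fin.val_last]; omega)]
  split_ifs with h1 h2
  · refine ⟨Uv ^ ((L.getD j 0).natAbs - 1), ?_⟩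
    rw [← pow_succ', Nat.sub_add_cancel]
    exact Int.natAbs_pos.2 h1.2.ne'
  · rw [Fin.val_last] at h1
    rw [h1.1, Nat.odd_add_one, Nat.not_odd_iff_even, Nat.even_iff] at hodd
    exact absurd hodd h2
  · exact ⟨0, by simp⟩

lemma map_mem_uSub {C₁ C₂ : PreCx} (f : Msub C₁ →ₗ[RUV] Msub C₂) {x : Msub C₁}
    (hx : x ∈ uSub C₁) : f x ∈ uSub C₂ := by
  obtain ⟨u, rfl⟩ := hx
  exact ⟨f u, by simp⟩

/-- The image of the last generator of a semistandard complex is `V`-torsion modulo `U`. -/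
lemma exists_Vv_pow_smul_last_mem_bdryU (L : List ℤ) (hodd : Odd L.length) {C : PreCx}
    (hC : IsKnotLike C) {f : Msub (SemiStdCx L) →ₗ[RUV] Msub C} (hf : IsSemiLocalMap L C f) :
    ∃ b : ℕ, 0 < b ∧ Vv ^ b • f (Finsupp.single (Fin.last L.length) 1) ∈ bdryU C := by
  obtain ⟨hchain, hgr, -⟩ := hf
  by_contra! hcon
  have htop : ∀ k : ℕ, Vv ^ k • f (Finsupp.single (Fin.last L.length) 1) ∉ bdryU C := by
    intro k hk
    refine hcon (k + 1) k.succ_pos ?_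
    rw [pow_succ', mul_smul]
    exact Submodule.smul_mem _ _ hk
  have hcyc : dmap C (f (Finsupp.single (Fin.last L.length) 1)) ∈ uSub C := by
    rw [← hchain]
    exact map_mem_uSub f (dmap_semiStd_last_mem_uSub L hodd)
  have h0 := hC.vTowerGr _ _ _ (hgr.chainHomog (Fin.last L.length)) hcyc htop
  have h1 := (odd_grRel_fst_iff L L.length).2 hodd
  have h2 : (grRel L L.length).1 + 0 = 0 := h0
  rw [← add_zero (grRel L L.length).1, h2] at h1
  exact absurd h1 (by decide)

/-- Extend a map from the semistandard complex of `L` by a value on the generator added by one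
further parameter. -/
def extendMap (L : List ℤ) (b : ℤ) {C : PreCx} (f : Msub (SemiStdCx L) →ₗ[RUV] Msub C)
    (y : Msub C) : Msub (StdCx (L ++ [b])) →ₗ[RUV] Msub C :=
  Finsupp.linearCombination RUV fun i : Fin ((L ++ [b]).length + 1) =>
    if h : (i : ℕ) < L.length + 1 then
      f (Finsupp.single (⟨i, h⟩ : Fin (L.length + 1)) 1) else y

section extendMap

variable (L : List ℤ) (b : ℤ) {C : PreCx} (f : Msub (SemiStdCx L) →ₗ[RUV] Msub C) (y : Msub C)

lemma extendMap_single_of_lt (i : Fin ((L ++ [b]).length + 1)) (h : (i : ℕ) < L.length + 1) :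
    extendMap L b f y (Finsupp.single i 1) =
      f (Finsupp.single (⟨i, h⟩ : Fin (L.length + 1)) 1) := by
  refine (Finsupp.linearCombination_single RUV _ i).trans ?_
  rw [one_smul, dif_pos h]

lemma extendMap_single_of_not_lt (i : Fin ((L ++ [b]).length + 1))
    (h : ¬ (i : ℕ) < L.length + 1) : extendMap L b f y (Finsupp.single i 1) = y := by
  refine (Finsupp.linearCombination_single RUV _ i).trans ?_
  rw [one_smul, dif_neg h]

lemma sum_fin_append {M : Type*} [AddCommMonoid M] (F : Fin ((L ++ [b]).length + 1) → M) :
    ∑ j, F j = (∑ j : Fin (L.length + 1), F ⟨j, by grind⟩) +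
      F ⟨L.length + 1, by simp⟩ := by
  have key : ∀ (N : ℕ) (hN : N = L.length + 1 + 1) (F : Fin N → M),
      ∑ j, F j = (∑ j : Fin (L.length + 1), F ⟨j, by omega⟩) + F ⟨L.length + 1, by omega⟩ := by
    rintro _ rfl F
    exact Fin.sum_univ_castSucc F
  exact key _ (by simp) F

lemma extendMap_dmap_single (i : Fin ((L ++ [b]).length + 1)) :
    extendMap L b f y (dmap (StdCx (L ++ [b])) (Finsupp.single i 1)) =
      (∑ j : Fin (L.length + 1), stdDm (L ++ [b]) i ⟨j, by grind⟩ •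
        f (Finsupp.single j 1)) + stdDm (L ++ [b]) i ⟨L.length + 1, by simp⟩ • y := by
  refine (map_dmap_single (StdCx (L ++ [b])) _ i).trans ((sum_fin_append L b _).trans ?_)
  congr 1
  · refine Finset.sum_congr rfl fun j _ => ?_
    rw [extendMap_single_of_lt L b f y _ j.isLt]
    rfl
  · rw [extendMap_single_of_not_lt L b f y _ (lt_irrefl _)]
    rfl

lemma stdDm_append (i j : Fin (L.length + 1)) :
    stdDm (L ++ [b]) ⟨i, by grind⟩ ⟨j, by grind⟩ = stdDm L i j := by
  have hget : ∀ k < L.length, (L ++ [b]).getD k 0 = L.getD k 0 := fun k hk =>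
    List.getD_append _ _ _ _ hk
  unfold stdDm
  by_cases h1 : (j : ℕ) = i + 1
  · simp only [h1, true_and, hget i (by omega)]
    simp [show ¬ (i : ℕ) = i + 1 + 1 by omega]
  · by_cases h2 : (i : ℕ) = j + 1
    · simp only [h2, true_and, hget j (by omega)]
      rw [if_neg (fun h => by omega : ¬ ((j : ℕ) = j + 1 + 1 ∧ _)),
        if_neg (fun h => by omega : ¬ ((j : ℕ) = j + 1 + 1 ∧ _))]
    · simp [h1, h2]

lemma getD_append_length : (L ++ [b]).getD L.length 0 = b := by simp

lemma extendMap_chain (hb : 0 < b) (hf : ∀ x, f (dmap (SemiStdCx L) x) = dmap C (f x))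
    (i : Fin ((L ++ [b]).length + 1)) (hi : (i : ℕ) < L.length + 1) :
    extendMap L b f y (dmap (StdCx (L ++ [b])) (Finsupp.single i 1)) =
      dmap C (extendMap L b f y (Finsupp.single i 1)) := by
  rw [extendMap_single_of_lt L b f y i hi, ← hf, extendMap_dmap_single]
  have hlast : stdDm (L ++ [b]) i ⟨L.length + 1, by simp⟩ = 0 := by
    unfold stdDm
    rw [if_neg, if_neg]
    · rintro ⟨h, -⟩
      simp only at h
      omega
    · rintro ⟨h, h'⟩
      have hi' : (i : ℕ) = L.length := by simp only at h; omega
      rw [hi', getD_append_length] at h'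
      omega
  rw [hlast, zero_smul, add_zero]
  refine Eq.trans ?_ (map_dmap_single (SemiStdCx L) f (⟨i, hi⟩ : Fin (L.length + 1))).symm
  refine Finset.sum_congr rfl fun j _ => ?_
  exact congrArg (· • f (Finsupp.single j 1)) (stdDm_append L b ⟨i, hi⟩ j)

lemma extendMap_dmap_last (hodd : Odd L.length) (hb : 0 < b) :
    extendMap L b f y
        (dmap (StdCx (L ++ [b])) (Finsupp.single (Fin.last (L ++ [b]).length) 1)) =
      Vv ^ b.natAbs • f (Finsupp.single (Fin.last L.length) 1) := by
  have hlen : (L ++ [b]).length = L.length + 1 := by simp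
  rw [extendMap_dmap_single, Finset.sum_eq_single (Fin.last L.length)]
  · have h1 : stdDm (L ++ [b]) (Fin.last _) ⟨(Fin.last L.length : Fin _), by simp⟩ =
        Vv ^ b.natAbs := by
      unfold stdDm
      simp only [Fin.val_last, hlen]
      rw [if_neg (by omega), if_pos ⟨trivial, by rwa [getD_append_length]⟩, getD_append_length,
        if_neg (by rw [Nat.odd_iff.1 hodd]; decide)]
    have h2 : stdDm (L ++ [b]) (Fin.last _) ⟨L.length + 1, by simp⟩ = 0 := by
      unfold stdDm
      simp only [Fin.val_last, hlen]
      rw [if_neg (by omega), if_neg (by omega)]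
    rw [h1, h2, zero_smul, add_zero]
  · intro j _ hj
    have hj' : (j : ℕ) ≠ L.length := fun h => hj (Fin.ext h)
    have : stdDm (L ++ [b]) (Fin.last _) ⟨j, by grind⟩ = 0 := by
      unfold stdDm
      simp only [Fin.val_last, hlen]
      rw [if_neg (by omega), if_neg (by omega)]
    rw [this, zero_smul]
  · simp

lemma stdGr_append_of_lt (hodd : Odd L.length) (hb : 0 < b) (i : Fin ((L ++ [b]).length + 1))
    (hi : (i : ℕ) < L.length + 1) :
    (stdGr (L ++ [b]) i).1 = (semiGr L ⟨i, hi⟩).1 ∧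
      (stdGr (L ++ [b]) i).2 + (2 - 2 * b) = (semiGr L ⟨i, hi⟩).2 := by
  have h := grRel_append L [b] (i := i) (by omega)
  have h' := grRel_append L [b] (i := L.length) le_rfl
  have hmod : ¬ L.length % 2 = 0 := by rw [Nat.odd_iff.1 hodd]; decide
  have hlen : (L ++ [b]).length = L.length + 1 := by simp
  simp only [stdGr, semiGr, h, hlen, grRel_succ, h', getD_append_length, Prod.snd_add, stepShift,
    if_neg hmod, if_neg hb.not_gt, true_and]
  rw [Int.natAbs_of_nonneg hb.le]
  ring

lemma stdGr_append_last (hodd : Odd L.length) (hb : 0 < b) (i : Fin ((L ++ [b]).length + 1))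
    (hi : ¬ (i : ℕ) < L.length + 1) :
    (stdGr (L ++ [b]) i).1 = (semiGr L (Fin.last _)).1 + 1 ∧
      (stdGr (L ++ [b]) i).2 + (2 - 2 * b) = (semiGr L (Fin.last _)).2 - 2 * b + 1 := by
  have hlen : (L ++ [b]).length = L.length + 1 := by simp
  have h' := grRel_append L [b] (i := L.length) le_rfl
  have hmod : ¬ L.length % 2 = 0 := by rw [Nat.odd_iff.1 hodd]; decide
  have hil : (i : ℕ) = L.length + 1 := by have := i.isLt; omega
  simp only [stdGr, semiGr, hil, hlen, Fin.val_last, grRel_succ, h', getD_append_length,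
    Prod.snd_add, Prod.fst_add, stepShift, if_neg hmod, if_neg hb.not_gt, true_and]
  ring

lemma extendMap_homog (hodd : Odd L.length) (hb : 0 < b) (hf : MapHomogShift (SemiStdCx L) C f 0 0)
    (hy : ChainHomog C y ((semiGr L (Fin.last _)).1 + 1)
      ((semiGr L (Fin.last _)).2 - 2 * b + 1)) :
    MapHomogShift (StdCx (L ++ [b])) C (extendMap L b f y) 0 (2 - 2 * b) := by
  intro i
  change ChainHomog C _ ((stdGr (L ++ [b]) i).1 + 0) ((stdGr (L ++ [b]) i).2 + (2 - 2 * b))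
  by_cases hi : (i : ℕ) < L.length + 1
  · obtain ⟨h1, h2⟩ := stdGr_append_of_lt L b hodd hb i hi
    rw [extendMap_single_of_lt L b f y i hi, h1, h2, ← add_zero (semiGr L ⟨i, hi⟩).2]
    exact hf.chainHomog (⟨i, hi⟩ : Fin (L.length + 1))
  · obtain ⟨h1, h2⟩ := stdGr_append_last L b hodd hb i hi
    rw [extendMap_single_of_not_lt L b f y i hi, h1, h2, add_zero]
    exact hy

end extendMap

end

/-- Let `f : C'(b_1, …, b_n) → C` be a local map from a semistandard
complex (`n` odd) to a (reduced) knot-like complex `C`.  Then there is some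
`b_{n+1} > 0` and a short local map `g : C(b_1, …, b_n, b_{n+1}) ⇝ C` from the standard
complex `C(b_1, …, b_n, b_{n+1})` to `C` agreeing with `f` on `x_0, …, x_n`. -/
theorem semistandard_to_standard_short_local_map
    (L : List ℤ) (hodd : Odd L.length) (hnz : ∀ b ∈ L, b ≠ 0)
    (C : PreCx) (hC : IsKnotLike C) (hred : Reduced C)
    (f : Msub (SemiStdCx L) →ₗ[RUV] Msub C) (hf : IsSemiLocalMap L C f) :
    ∃ b : ℤ, 0 < b ∧
      ∃ g : Msub (StdCx (L ++ [b])) →ₗ[RUV] Msub C,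
        IsShortLocalMap (L ++ [b]) C g ∧
        ∀ i : Fin (L.length + 1),
          g (Finsupp.single (⟨(i : ℕ), by
            have := i.isLt
            simp only [List.length_append, List.length_cons, List.length_nil]
            omega⟩ : Fin ((L ++ [b]).length + 1)) 1) = f (Finsupp.single i 1) := by
  obtain ⟨b, hb, hmem⟩ := exists_Vv_pow_smul_last_mem_bdryU L hodd hC hf
  obtain ⟨hchain, hgr, htower⟩ := hf
  have hb' : (0 : ℤ) < b := by exact_mod_cast hb
  obtain ⟨y, hy, hdy⟩ := exists_homog_of_mem_bdryU hC.dhomog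
    (ChainHomog.smul (isHomog_Vv_pow b) (hgr.chainHomog (Fin.last L.length))) hmem
  have hlen : (L ++ [(b : ℤ)]).length = L.length + 1 := by simp
  refine ⟨b, hb', extendMap L b f y, ⟨⟨⟨2 - 2 * b, ?_⟩, ?_, ?_⟩, ?_⟩, ?_⟩
  · refine extendMap_homog L b f y hodd hb' hgr ?_
    change ChainHomog C y (0 + ((semiGr L (Fin.last _)).1 + 0) + 1)
      (-(2 * (b : ℤ)) + ((semiGr L (Fin.last _)).2 + 0) + 1) at hy
    convert hy using 1 <;> ring
  · intro i _ hi
    exact extendMap_chain L b f y hb' hchain i (by omega)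
  · rw [extendMap_dmap_last L b f y hodd hb',
      extendMap_single_of_not_lt L b f y _ (by rw [Fin.val_last]; omega), Int.natAbs_natCast]
    exact hdy
  · rw [extendMap_single_of_lt L b f y 0 (by simp)]
    exact htower
  · intro i
    exact extendMap_single_of_lt L b f y _ i.isLt
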